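/- (Optional Section Theorem) Let (Ω, F, ℙ) be a probability space with a filtration (F_t)_{t∈ℝ₊} satisfying ⋁_t F_t ⊆ F. For every set O in the optional σ-algebra 𝒪 and every ε > 0 there exists a stopping time τ such that the graph ⟦τ⟧ is contained in O and ℙ*(π_Ω(O)) − ℙ({τ < ∞}) ≤ ε. -/

import Mathlib

open MeasureTheory Set
open scoped NNReal ENNReal


variable {Ω : Type*}

/-- A stopping time with respect to the filtration `𝔽`. -/
def IsStopTime {F : MeasurableSpace Ω} (𝔽 : Filtration ℝ≥0 F) (τ : Ω → ℝ≥0∞) : Prop :=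
  ∀ t : ℝ≥0, MeasurableSet[𝔽 t] {ω | τ ω ≤ (t : ℝ≥0∞)}

/-- A predictable time: a stopping time announced by a nondecreasing sequence of
finite stopping times. -/
def IsPredTime {F : MeasurableSpace Ω} (𝔽 : Filtration ℝ≥0 F) (ρ : Ω → ℝ≥0∞) : Prop :=
  IsStopTime 𝔽 ρ ∧ ∃ ρs : ℕ → Ω → ℝ≥0∞,
    (∀ n, IsStopTime 𝔽 (ρs n)) ∧ (∀ n ω, ρs n ω < ⊤) ∧ (∀ n ω, ρs n ω ≤ ρ ω) ∧
    (∀ n ω, 0 < ρ ω → ρs n ω < ρ ω) ∧ (∀ ω, Monotone fun n => ρs n ω) ∧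
    (∀ ω, Filter.Tendsto (fun n => ρs n ω) Filter.atTop (nhds (ρ ω)))

/-- The graph `⟦τ⟧ ⊆ Ω × ℝ₊` of `τ : Ω → [0,∞]`. -/
def graph (τ : Ω → ℝ≥0∞) : Set (Ω × ℝ≥0) := {p | τ p.1 = (p.2 : ℝ≥0∞)}

/-- The stochastic interval `⟦τ, ∞⟦`. -/
def rayFrom (τ : Ω → ℝ≥0∞) : Set (Ω × ℝ≥0) := {p | τ p.1 ≤ (p.2 : ℝ≥0∞)}

/-- The stochastic interval `⟦ρ, τ⟧`. -/
def stInterval (ρ τ : Ω → ℝ≥0∞) : Set (Ω × ℝ≥0) :=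
  {p | ρ p.1 ≤ (p.2 : ℝ≥0∞) ∧ (p.2 : ℝ≥0∞) ≤ τ p.1}

/-- The predictable σ-algebra on `Ω × ℝ₊`. -/
def predictableSigma {F : MeasurableSpace Ω} (𝔽 : Filtration ℝ≥0 F) :
    MeasurableSpace (Ω × ℝ≥0) :=
  MeasurableSpace.generateFrom {s | ∃ ρ, IsPredTime 𝔽 ρ ∧ s = rayFrom ρ}

/-- The optional σ-algebra on `Ω × ℝ₊`. -/
def optionalSigma {F : MeasurableSpace Ω} (𝔽 : Filtration ℝ≥0 F) :
    MeasurableSpace (Ω × ℝ≥0) :=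
  MeasurableSpace.generateFrom {s | ∃ τ, IsStopTime 𝔽 τ ∧ s = rayFrom τ}

/-- The debut of a set `S ⊆ Ω × ℝ₊`. -/
noncomputable def debut (S : Set (Ω × ℝ≥0)) (ω : Ω) : ℝ≥0∞ :=
  ⨅ (t : ℝ≥0) (_ : (ω, t) ∈ S), (t : ℝ≥0∞)

/-- Projection of a subset of `Ω × ℝ₊` onto `Ω`. -/
def projOmega (S : Set (Ω × ℝ≥0)) : Set Ω := Prod.fst '' S

/-- The outer measure `ℙ*` induced by `ℙ`. -/
noncomputable def pstar {F : MeasurableSpace Ω} (P : Measure Ω) (A : Set Ω) : ℝ≥0∞ :=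
  ⨅ (E : Set Ω) (_ : A ⊆ E) (_ : MeasurableSet E), P E

section StopTime

variable {F : MeasurableSpace Ω} {𝔽 : Filtration ℝ≥0 F}

lemma IsStopTime.measurable {τ : Ω → ℝ≥0∞} (hτ : IsStopTime 𝔽 τ) : Measurable τ := by
  refine measurable_of_Iic fun c => ?_
  induction c with
  | top => simp
  | coe t => exact 𝔽.le t _ (hτ t)

lemma IsStopTime.min {σ τ : Ω → ℝ≥0∞} (hσ : IsStopTime 𝔽 σ) (hτ : IsStopTime 𝔽 τ) :
    IsStopTime 𝔽 fun ω => min (σ ω) (τ ω) := by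
  intro t
  simp only [min_le_iff, ofPred_or]
  exact (hσ t).union (hτ t)

lemma IsStopTime.max {σ τ : Ω → ℝ≥0∞} (hσ : IsStopTime 𝔽 σ) (hτ : IsStopTime 𝔽 τ) :
    IsStopTime 𝔽 fun ω => max (σ ω) (τ ω) := by
  intro t
  simp only [max_le_iff, ofPred_and]
  exact (hσ t).inter (hτ t)

lemma IsStopTime.iSup {τ : ℕ → Ω → ℝ≥0∞} (hτ : ∀ n, IsStopTime 𝔽 (τ n)) :
    IsStopTime 𝔽 fun ω => ⨆ n, τ n ω := by
  intro t
  simp only [iSup_le_iff, ofPred_forall]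
  exact MeasurableSet.iInter fun n => hτ n t

lemma IsStopTime.measurableSet_le_and_lt {σ τ : Ω → ℝ≥0∞} (hσ : IsStopTime 𝔽 σ)
    (hτ : IsStopTime 𝔽 τ) (t : ℝ≥0) :
    MeasurableSet[𝔽 t] {ω | σ ω ≤ t ∧ σ ω < τ ω} := by
  have h : {ω | σ ω ≤ t ∧ σ ω < τ ω} = ({ω | σ ω ≤ t} ∩ {ω | τ ω ≤ t}ᶜ) ∪
      ⋃ (q : ℚ) (_ : Real.toNNReal q ≤ t),
        ({ω | σ ω ≤ (Real.toNNReal q : ℝ≥0∞)} ∩ {ω | τ ω ≤ (Real.toNNReal q : ℝ≥0∞)}ᶜ) := by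
    ext ω
    simp only [mem_ofPred_eq, mem_union, mem_inter_iff, mem_compl_iff, mem_iUnion, not_le,
      exists_prop]
    constructor
    · rintro ⟨h1, h2⟩
      rcases lt_or_ge (t : ℝ≥0∞) (τ ω) with h3 | h3
      · exact Or.inl ⟨h1, h3⟩
      · obtain ⟨q, -, hq1, hq2⟩ := ENNReal.lt_iff_exists_rat_btwn.1 h2
        exact Or.inr ⟨q, ENNReal.coe_le_coe.1 (hq2.le.trans h3), hq1.le, hq2⟩
    · rintro (⟨h1, h2⟩ | ⟨q, hq, h1, h2⟩)
      · exact ⟨h1, h1.trans_lt h2⟩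
      · exact ⟨h1.trans (ENNReal.coe_le_coe.2 hq), h1.trans_lt h2⟩
  rw [h]
  refine ((hσ t).inter (hτ t).compl).union
    (MeasurableSet.iUnion fun q => MeasurableSet.iUnion fun hq => ?_)
  exact 𝔽.mono hq _ ((hσ _).inter (hτ _).compl)

lemma IsStopTime.measurableSet_le_and_le {σ τ : Ω → ℝ≥0∞} (hσ : IsStopTime 𝔽 σ)
    (hτ : IsStopTime 𝔽 τ) (t : ℝ≥0) :
    MeasurableSet[𝔽 t] {ω | σ ω ≤ t ∧ τ ω ≤ σ ω} := by
  have h : {ω | σ ω ≤ t ∧ τ ω ≤ σ ω} = {ω | σ ω ≤ t} \ {ω | σ ω ≤ t ∧ σ ω < τ ω} := by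
    ext ω
    simp only [mem_ofPred_eq, mem_sdiff, not_and, not_lt]
    tauto
  rw [h]
  exact (hσ t).diff (hσ.measurableSet_le_and_lt hτ t)

open Classical in
lemma IsStopTime.restrict {σ : Ω → ℝ≥0∞} {p : Ω → Prop}
    (h : ∀ t : ℝ≥0, MeasurableSet[𝔽 t] {ω | σ ω ≤ t ∧ p ω}) :
    IsStopTime 𝔽 fun ω => if p ω then σ ω else ⊤ := by
  intro t
  convert h t using 3 with ω
  by_cases hp : p ω <;> simp [hp]

lemma measurableSet_rayFrom {τ : Ω → ℝ≥0∞} (hτ : Measurable τ) : MeasurableSet (rayFrom τ) :=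
  measurableSet_le (hτ.comp measurable_fst) (measurable_coe_nnreal_ennreal.comp measurable_snd)

lemma optionalSigma_le_prod : optionalSigma 𝔽 ≤ F.prod inferInstance := by
  refine MeasurableSpace.generateFrom_le ?_
  rintro _ ⟨τ, hτ, rfl⟩
  exact measurableSet_rayFrom hτ.measurable

/-- `B` admits, after every stopping time `σ`, a stopping time with graph in `B` which is almost
surely the debut of `B ∩ ⟦σ, ∞⟦`. -/
def HasAttainedDebuts (𝔽 : Filtration ℝ≥0 F) (P : Measure Ω) (B : Set (Ω × ℝ≥0)) : Prop :=
  ∀ σ, IsStopTime 𝔽 σ → ∃ τ, IsStopTime 𝔽 τ ∧ graph τ ⊆ B ∧ σ ≤ τ ∧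
    ∀ᵐ ω ∂P, ∀ t : ℝ≥0, (ω, t) ∈ B → σ ω ≤ t → τ ω ≤ t

variable {P : Measure Ω}

lemma hasAttainedDebuts_rayFrom {τ : Ω → ℝ≥0∞} (hτ : IsStopTime 𝔽 τ) :
    HasAttainedDebuts 𝔽 P (rayFrom τ) := by
  intro σ hσ
  refine ⟨_, hσ.max hτ, ?_, fun ω => le_max_left _ _, ?_⟩
  · rintro ⟨ω, t⟩ h
    exact (le_max_right _ _).trans_eq h
  · exact ae_of_all _ fun ω t h1 h2 => max_le h2 h1

lemma hasAttainedDebuts_compl_rayFrom {τ : Ω → ℝ≥0∞} (hτ : IsStopTime 𝔽 τ) :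
    HasAttainedDebuts 𝔽 P (rayFrom τ)ᶜ := by
  classical
  intro σ hσ
  refine ⟨_, IsStopTime.restrict (hσ.measurableSet_le_and_lt hτ), ?_, ?_, ?_⟩
  · rintro ⟨ω, t⟩ h
    simp only [graph, mem_ofPred_eq] at h
    split_ifs at h with hlt
    · simpa [rayFrom, ← h] using hlt
    · simp at h
  · intro ω
    dsimp only
    split_ifs <;> simp
  · refine ae_of_all _ fun ω t h1 h2 => ?_
    have h3 : (t : ℝ≥0∞) < τ ω := not_le.1 h1
    rwa [if_pos (h2.trans_lt h3)]

lemma hasAttainedDebuts_empty : HasAttainedDebuts 𝔽 P ∅ := by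
  intro σ _
  refine ⟨fun _ => ⊤, fun t => by simp, ?_, fun ω => le_top, by simp⟩
  rintro ⟨ω, t⟩ h
  simp [graph] at h

lemma HasAttainedDebuts.union {B C : Set (Ω × ℝ≥0)} (hB : HasAttainedDebuts 𝔽 P B)
    (hC : HasAttainedDebuts 𝔽 P C) : HasAttainedDebuts 𝔽 P (B ∪ C) := by
  intro σ hσ
  obtain ⟨τ, hτ, hτB, hστ, hae⟩ := hB σ hσ
  obtain ⟨ρ, hρ, hρC, hσρ, hae'⟩ := hC σ hσ
  refine ⟨_, hτ.min hρ, ?_, fun ω => le_min (hστ ω) (hσρ ω), ?_⟩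
  · rintro ⟨ω, t⟩ h
    rcases min_choice (τ ω) (ρ ω) with h' | h'
    · exact Or.inl (hτB (h'.symm.trans h))
    · exact Or.inr (hρC (h'.symm.trans h))
  · filter_upwards [hae, hae'] with ω h1 h2 t ht hσt
    rcases ht with ht | ht
    · exact (min_le_left _ _).trans (h1 t ht hσt)
    · exact (min_le_right _ _).trans (h2 t ht hσt)

lemma HasAttainedDebuts.biUnion_lt {B : ℕ → Set (Ω × ℝ≥0)}
    (hB : ∀ n, HasAttainedDebuts 𝔽 P (B n)) (N : ℕ) :
    HasAttainedDebuts 𝔽 P (⋃ n < N, B n) := by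
  induction N with
  | zero => simpa using hasAttainedDebuts_empty
  | succ N ih =>
    rw [biUnion_lt_succ]
    exact ih.union (hB N)

/-- A family of stopping times closed under countable suprema has an almost surely maximal
element. -/
lemma exists_ae_maximal_stopTime [IsFiniteMeasure P] {p : (Ω → ℝ≥0∞) → Prop}
    (hpτ : ∀ τ, p τ → IsStopTime 𝔽 τ) (hne : ∃ τ, p τ)
    (hsup : ∀ τ : ℕ → Ω → ℝ≥0∞, (∀ n, p (τ n)) → p fun ω => ⨆ n, τ n ω) :
    ∃ σ, p σ ∧ ∀ τ, p τ → σ ≤ τ → τ =ᵐ[P] σ := by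
  let I : (Ω → ℝ≥0∞) → ℝ≥0∞ := fun τ => ∫⁻ ω, (1 + τ ω)⁻¹ ∂P
  have hI : ∀ {σ τ : Ω → ℝ≥0∞}, σ ≤ τ → I τ ≤ I σ := fun h =>
    lintegral_mono fun ω => ENNReal.inv_le_inv.2 (by gcongr; exact h ω)
  obtain ⟨τ₀, hτ₀⟩ := hne
  obtain ⟨u, -, hu, hmem⟩ := exists_seq_tendsto_sInf (S := I '' {τ | p τ})
    ⟨_, τ₀, hτ₀, rfl⟩ (OrderBot.bddBelow _)
  choose τ hτ hIτ using hmem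
  have hσ := hsup τ hτ
  refine ⟨_, hσ, fun ρ hρ hle => ?_⟩
  have hmin : I (fun ω => ⨆ n, τ n ω) ≤ I ρ := by
    refine le_trans (ge_of_tendsto' hu fun n => ?_) (sInf_le ⟨ρ, hρ, rfl⟩)
    rw [← hIτ]
    exact hI fun ω => le_iSup (fun n => τ n ω) n
  have hfin : I ρ ≠ ⊤ := by
    refine ne_top_of_le_ne_top (measure_ne_top P univ) ?_
    calc I ρ ≤ ∫⁻ _, 1 ∂P := lintegral_mono fun ω => by simp
      _ = P univ := by simp
  have hae := ae_eq_of_ae_le_of_lintegral_le (μ := P)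
    (f := fun ω => (1 + ρ ω)⁻¹) (g := fun ω => (1 + ⨆ n, τ n ω)⁻¹)
    (ae_of_all _ fun ω => ENNReal.inv_le_inv.2 (by gcongr; exact hle ω)) hfin
    ((measurable_const.add (hpτ _ hσ).measurable).inv.aemeasurable) hmin
  filter_upwards [hae] with ω h
  exact (ENNReal.add_right_inj ENNReal.one_ne_top).1 (inv_injective h)

lemma HasAttainedDebuts.iInter [IsFiniteMeasure P] {B : ℕ → Set (Ω × ℝ≥0)}
    (hB : ∀ n, HasAttainedDebuts 𝔽 P (B n)) : HasAttainedDebuts 𝔽 P (⋂ n, B n) := by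
  classical
  intro σ hσ
  let p : (Ω → ℝ≥0∞) → Prop := fun τ => IsStopTime 𝔽 τ ∧ σ ≤ τ ∧
    ∀ᵐ ω ∂P, ∀ t : ℝ≥0, (ω, t) ∈ ⋂ n, B n → σ ω ≤ t → τ ω ≤ t
  obtain ⟨ρ, ⟨hρ, hσρ, hρae⟩, hmax⟩ := exists_ae_maximal_stopTime (P := P) (p := p)
    (fun τ h => h.1) ⟨σ, hσ, le_rfl, ae_of_all _ fun ω t _ h => h⟩ (by
      intro τ h
      refine ⟨IsStopTime.iSup fun n => (h n).1,
        fun ω => ((h 0).2.1 ω).trans (le_iSup (fun n => τ n ω) 0), ?_⟩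
      filter_upwards [ae_all_iff.2 fun n => (h n).2.2] with ω hω t ht hσt
      exact iSup_le fun n => hω n t ht hσt)
  choose τ hτ hτB hρτ hτae using fun n => hB n ρ hρ
  have heq : ∀ n, τ n =ᵐ[P] ρ := fun n => by
    refine hmax _ ⟨hτ n, hσρ.trans (hρτ n), ?_⟩ (hρτ n)
    filter_upwards [hρae, hτae n] with ω h1 h2 t ht hσt
    exact h2 t (mem_iInter.1 ht n) (h1 t ht hσt)
  refine ⟨_, IsStopTime.restrict (σ := ρ) (p := fun ω => ∀ n, τ n ω ≤ ρ ω) fun t => ?_,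
    ?_, ?_, ?_⟩
  · have : {ω | ρ ω ≤ t ∧ ∀ n, τ n ω ≤ ρ ω} = ⋂ n, {ω | ρ ω ≤ t ∧ τ n ω ≤ ρ ω} := by
      ext ω
      simp [forall_and]
    rw [this]
    exact MeasurableSet.iInter fun n => hρ.measurableSet_le_and_le (hτ n) t
  · rintro ⟨ω, t⟩ h
    simp only [graph, mem_ofPred_eq] at h
    split_ifs at h with hle
    · exact mem_iInter.2 fun n => hτB n (((hle n).antisymm (hρτ n ω)).trans h)
    · simp at h
  · intro ω
    dsimp only
    split_ifs
    · exact hσρ ω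
    · exact le_top
  · filter_upwards [ae_all_iff.2 heq, hρae] with ω h1 h2 t ht hσt
    rw [if_pos fun n => (h1 n).le]
    exact h2 t ht hσt

lemma MeasurableSet.exists_hasAttainedDebuts_subset [IsFiniteMeasure P]
    (μ : Measure (Ω × ℝ≥0)) [IsFiniteMeasure μ] {O : Set (Ω × ℝ≥0)}
    (hO : MeasurableSet[optionalSigma 𝔽] O) {ε : ℝ≥0∞} (hε : ε ≠ 0) :
    ∃ B ⊆ O, HasAttainedDebuts 𝔽 P B ∧ μ (O \ B) ≤ ε := by
  let q : Set (Ω × ℝ≥0) → Prop := fun S => ∀ ε : ℝ≥0∞, ε ≠ 0 →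
    ∃ B ⊆ S, HasAttainedDebuts 𝔽 P B ∧ μ (S \ B) ≤ ε
  have hq : ∀ {S}, HasAttainedDebuts 𝔽 P S → q S := fun h ε _ => ⟨_, Subset.rfl, h, by simp⟩
  suffices h : q O ∧ q Oᶜ from h.1 ε hε
  induction O, hO using MeasurableSpace.generateFrom_induction with
  | hC s hs =>
    obtain ⟨τ, hτ, rfl⟩ := hs
    exact ⟨hq (hasAttainedDebuts_rayFrom hτ), hq (hasAttainedDebuts_compl_rayFrom hτ)⟩
  | empty =>
    refine ⟨hq hasAttainedDebuts_empty, hq ?_⟩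
    have : (univ : Set (Ω × ℝ≥0)) = rayFrom fun _ => 0 := by
      ext
      simp [rayFrom]
    rw [compl_empty, this]
    exact hasAttainedDebuts_rayFrom fun t => by simp
  | compl s _ ih => exact ⟨ih.2, by rw [compl_compl]; exact ih.1⟩
  | iUnion s hs ih =>
    constructor
    · intro ε hε
      obtain ⟨δ, hδ, hδε⟩ := ENNReal.exists_pos_sum_of_countable' (ENNReal.half_pos hε).ne' ℕ
      choose B hBs hB hμB using fun n => (ih n).1 (δ n) (hδ n).ne'
      have hmeas : ∀ N, MeasurableSet (⋃ n < N, s n) := fun N =>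
        MeasurableSet.iUnion fun n => MeasurableSet.iUnion fun _ => optionalSigma_le_prod _ (hs n)
      have hmono : Monotone fun N => ⋃ n < N, s n := fun N M h =>
        biUnion_subset_biUnion_left fun n (hn : n < N) => hn.trans_le h
      have hU : ⋃ N, ⋃ n < N, s n = ⋃ n, s n := by
        ext x
        simp only [mem_iUnion, exists_prop]
        exact ⟨fun ⟨_, n, _, h⟩ => ⟨n, h⟩, fun ⟨n, h⟩ => ⟨n + 1, n, n.lt_succ_self, h⟩⟩
      have hlim := tendsto_measure_iInter_atTop (μ := μ)
        (s := fun N => (⋃ n, s n) \ ⋃ n < N, s n)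
        (fun N => ((MeasurableSet.iUnion fun n =>
          optionalSigma_le_prod _ (hs n)).diff (hmeas N)).nullMeasurableSet)
        (fun N M h => sdiff_subset_sdiff_right (hmono h)) ⟨0, measure_ne_top _ _⟩
      rw [← sdiff_iUnion, hU, sdiff_self, measure_empty] at hlim
      obtain ⟨N, hN⟩ := (hlim.eventually_le_const (ENNReal.half_pos hε)).exists
      refine ⟨⋃ n < N, B n, ?_, HasAttainedDebuts.biUnion_lt hB N, ?_⟩
      · exact iUnion_subset fun n => iUnion_subset fun _ => (hBs n).trans (subset_iUnion s n)
      · have hsub : (⋃ n, s n) \ ⋃ n < N, B n ⊆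
            ((⋃ n, s n) \ ⋃ n < N, s n) ∪ ⋃ n, s n \ B n := by
          rintro x ⟨hx, hxB⟩
          by_cases hxN : x ∈ ⋃ n < N, s n
          · simp only [mem_iUnion, exists_prop, not_exists, not_and] at hxN hxB
            obtain ⟨n, hn, hxn⟩ := hxN
            exact Or.inr (mem_iUnion.2 ⟨n, hxn, hxB n hn⟩)
          · exact Or.inl ⟨hx, hxN⟩
        calc μ ((⋃ n, s n) \ ⋃ n < N, B n)
            ≤ μ ((⋃ n, s n) \ ⋃ n < N, s n) + μ (⋃ n, s n \ B n) :=
              (measure_mono hsub).trans (measure_union_le _ _)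
          _ ≤ ε / 2 + ε / 2 := add_le_add hN
              ((measure_iUnion_le _).trans ((ENNReal.tsum_le_tsum hμB).trans hδε.le))
          _ = ε := ENNReal.add_halves ε
    · intro ε hε
      obtain ⟨δ, hδ, hδε⟩ := ENNReal.exists_pos_sum_of_countable' hε ℕ
      choose B hBs hB hμB using fun n => (ih n).2 (δ n) (hδ n).ne'
      rw [compl_iUnion]
      refine ⟨⋂ n, B n, iInter_mono hBs, HasAttainedDebuts.iInter hB, ?_⟩
      have hsub : (⋂ n, (s n)ᶜ) \ ⋂ n, B n ⊆ ⋃ n, (s n)ᶜ \ B n := by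
        rw [sdiff_iInter]
        exact iUnion_mono fun n => sdiff_subset_sdiff_left (iInter_subset _ n)
      exact (measure_mono hsub).trans
        ((measure_iUnion_le _).trans ((ENNReal.tsum_le_tsum hμB).trans hδε.le))

end StopTime

section MeasurableSection

open Filter Topology

/-- The continuous image of the Baire space is approximated in measure by the images of compact
subsets. -/
lemma exists_isCompact_measure_range_le {X : Type*} [TopologicalSpace X]
    [TopologicalSpace.MetrizableSpace X] [MeasurableSpace X] [OpensMeasurableSpace X]
    (Q : Measure X) [IsFiniteMeasure Q] {g : (ℕ → ℕ) → X} (hg : Continuous g)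
    {ε : ℝ≥0∞} (hε : ε ≠ 0) :
    ∃ L : Set (ℕ → ℕ), IsCompact L ∧ Q (range g) ≤ Q (g '' L) + ε := by
  let _ := TopologicalSpace.metrizableSpaceMetric X
  obtain ⟨δ, hδ, hδε⟩ := ENNReal.exists_pos_sum_of_countable' hε ℕ
  have hstep : ∀ (S : Set (ℕ → ℕ)) (m : ℕ),
      ∃ k, Q (g '' S) ≤ Q (g '' (S ∩ {x | x m ≤ k})) + δ m := by
    intro S m
    have hmono : Monotone fun k => g '' (S ∩ {x | x m ≤ k}) := fun k l hkl =>
      image_mono (inter_subset_inter_right _ fun x (hx : x m ≤ k) => hx.trans hkl)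
    have hU : ⋃ k, g '' (S ∩ {x | x m ≤ k}) = g '' S := by
      rw [← image_iUnion, ← inter_iUnion]
      congr 1
      exact inter_eq_left.2 fun x _ => mem_iUnion.2 ⟨x m, le_refl (x m)⟩
    have hlim := tendsto_measure_iUnion_atTop (μ := Q) hmono
    rw [hU] at hlim
    by_cases h0 : Q (g '' S) = 0
    · exact ⟨0, by simp [h0]⟩
    obtain ⟨k, hk⟩ := (hlim.eventually_const_lt
      (ENNReal.sub_lt_self (measure_ne_top _ _) h0 (hδ m).ne')).exists
    exact ⟨k, tsub_le_iff_right.1 hk.le⟩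
  choose kf hkf using hstep
  let S : ℕ → Set (ℕ → ℕ) := fun m => Nat.rec univ (fun m T => T ∩ {x | x m ≤ kf T m}) m
  let k : ℕ → ℕ := fun m => kf (S m) m
  have hS : ∀ m, S m = {x | ∀ i < m, x i ≤ k i} := by
    intro m
    induction m with
    | zero => simp [S]
    | succ m ih =>
      change S m ∩ {x | x m ≤ k m} = _
      rw [ih]
      ext x
      simp only [mem_inter_iff, mem_ofPred_eq, Nat.forall_lt_succ_right]
  have hle : ∀ m, Q (range g) ≤ Q (g '' S m) + ∑ i ∈ Finset.range m, δ i := by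
    intro m
    induction m with
    | zero => simp [S]
    | succ m ih =>
      refine ih.trans ?_
      rw [Finset.sum_range_succ, add_comm _ (δ m), ← add_assoc]
      gcongr
      exact hkf (S m) m
  have hL : IsCompact (univ.pi fun m => Iic (k m)) :=
    isCompact_univ_pi fun m => (finite_Iic (k m)).isCompact
  refine ⟨_, hL, ?_⟩
  have hsub : ⋂ m, closure (g '' S m) ⊆ g '' univ.pi fun m => Iic (k m) := by
    intro x hx
    have hx' : ∀ m : ℕ, ∃ n ∈ S m, dist x (g n) < 1 / ((m : ℝ) + 1) := fun m => by
      obtain ⟨_, ⟨n, hn, rfl⟩, h⟩ :=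
        Metric.mem_closure_iff.1 (mem_iInter.1 hx m) _ (Nat.one_div_pos_of_nat (α := ℝ))
      exact ⟨n, hn, h⟩
    choose n hnS hnx using hx'
    obtain ⟨l, hl, φ, hφ, hlim⟩ := hL.tendsto_subseq (x := fun m i => min (n m i) (k i))
      fun m i _ => mem_Iic.2 (min_le_right _ _)
    have hlim' : Tendsto (n ∘ φ) atTop (𝓝 l) := by
      rw [tendsto_pi_nhds] at hlim ⊢
      intro i
      refine (hlim i).congr' ?_
      filter_upwards [hφ.tendsto_atTop.eventually_gt_atTop i] with m hm
      have := hnS (φ m)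
      rw [hS] at this
      exact min_eq_left (this i hm)
    have h1 : Tendsto (g ∘ n) atTop (𝓝 x) := by
      rw [tendsto_iff_dist_tendsto_zero]
      refine squeeze_zero (fun _ => dist_nonneg) (fun m => ?_)
        tendsto_one_div_add_atTop_nhds_zero_nat
      rw [dist_comm]
      exact (hnx m).le
    exact ⟨l, hl, tendsto_nhds_unique ((hg.tendsto l).comp hlim') (h1.comp hφ.tendsto_atTop)⟩
  have hanti : Antitone fun m => closure (g '' S m) := by
    refine fun m l hml => closure_mono (image_mono ?_)
    rw [hS, hS]
    exact fun x hx i hi => hx i (hi.trans_le hml)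
  have hlim := tendsto_measure_iInter_atTop (μ := Q)
    (fun m => (isClosed_closure (s := g '' S m)).measurableSet.nullMeasurableSet) hanti
    ⟨0, measure_ne_top _ _⟩
  refine (ge_of_tendsto' (hlim.add_const ε) fun m => ?_).trans
    (add_le_add_left (measure_mono hsub) ε)
  exact (hle m).trans (add_le_add (measure_mono subset_closure)
    ((ENNReal.sum_le_tsum _).trans hδε.le))

/-- A product-measurable set is pulled back from a Borel set along a measurable map to the
Cantor space. -/
lemma MeasurableSet.exists_eq_preimage_cantor {F : MeasurableSpace Ω} {T : Type*}
    [MeasurableSpace T] {A : Set (Ω × T)} (hA : MeasurableSet A) :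
    ∃ φ : Ω → ℕ → Bool, Measurable φ ∧ ∃ A' : Set ((ℕ → Bool) × T), MeasurableSet A' ∧
      A = Prod.map φ id ⁻¹' A' := by
  classical
  rw [← generateFrom_prod] at hA
  induction A, hA using MeasurableSpace.generateFrom_induction with
  | hC s hs =>
    obtain ⟨E, hE, S, hS, rfl⟩ := hs
    refine ⟨fun ω _ => decide (ω ∈ E), measurable_pi_lambda _ fun _ => ?_,
      {x | x 0 = true} ×ˢ S, ?_, ?_⟩
    · exact measurable_to_bool (by simpa [preimage] using hE)
    · exact MeasurableSet.prod
        (measurableSet_eq_fun (measurable_pi_apply 0) measurable_const) hS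
    · ext ⟨ω, t⟩
      simp
  | empty => exact ⟨fun _ _ => true, measurable_const, ∅, MeasurableSet.empty, by simp⟩
  | compl s _ ih =>
    obtain ⟨φ, hφ, A', hA', rfl⟩ := ih
    exact ⟨φ, hφ, A'ᶜ, hA'.compl, rfl⟩
  | iUnion s _ ih =>
    choose φ hφ A' hA' heq using ih
    let θ : ℕ → (ℕ → Bool) → ℕ → Bool := fun n x k => x (Nat.pair n k)
    have hθ : ∀ n, Measurable (θ n) := fun n =>
      measurable_pi_lambda _ fun k => measurable_pi_apply _
    refine ⟨fun ω k => φ k.unpair.1 ω k.unpair.2, measurable_pi_lambda _ fun k =>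
      (measurable_pi_apply _).comp (hφ _), ⋃ n, Prod.map (θ n) id ⁻¹' A' n,
      MeasurableSet.iUnion fun n => ((hθ n).prodMap measurable_id) (hA' n), ?_⟩
    ext ⟨ω, t⟩
    simp only [heq, mem_iUnion, mem_preimage, Prod.map_apply, id, θ, Nat.unpair_pair]

lemma exists_isLeast_section {X : Type*} [TopologicalSpace X] [T2Space X] {K : Set (X × ℝ≥0)}
    (hK : IsCompact K) {x : X} (hx : x ∈ Prod.fst '' K) :
    ∃ t, (x, t) ∈ K ∧ debut K x = t := by
  have hc : IsCompact {t : ℝ≥0 | (x, t) ∈ K} := by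
    have : {t : ℝ≥0 | (x, t) ∈ K} = Prod.snd '' (K ∩ Prod.fst ⁻¹' {x}) := by
      ext t
      simp
    rw [this]
    exact (hK.inter_right (isClosed_singleton.preimage continuous_fst)).image continuous_snd
  obtain ⟨⟨_, s⟩, hs, rfl⟩ := hx
  obtain ⟨t, ht, hmin⟩ := hc.exists_isLeast ⟨s, hs⟩
  exact ⟨t, ht, le_antisymm (iInf₂_le t ht)
    (le_iInf₂ fun u hu => ENNReal.coe_le_coe.2 (hmin hu))⟩

lemma IsCompact.measurable_debut {X : Type*} [TopologicalSpace X] [T2Space X]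
    [MeasurableSpace X] [OpensMeasurableSpace X] {K : Set (X × ℝ≥0)} (hK : IsCompact K) :
    Measurable (debut K) := by
  refine measurable_of_Iic fun c => ?_
  induction c with
  | top => simp
  | coe c =>
    have : debut K ⁻¹' Iic (c : ℝ≥0∞) = Prod.fst '' (K ∩ Prod.snd ⁻¹' Iic c) := by
      ext x
      constructor
      · intro hx
        have hne : x ∈ Prod.fst '' K := by
          by_contra hne
          have : debut K x = ⊤ := iInf₂_eq_top.2 fun t ht => absurd ⟨_, ht, rfl⟩ hne
          rw [mem_preimage, this] at hx
          simp at hx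
        obtain ⟨t, ht, hd⟩ := exists_isLeast_section hK hne
        rw [mem_preimage, hd, mem_Iic, ENNReal.coe_le_coe] at hx
        exact ⟨(x, t), ⟨ht, hx⟩, rfl⟩
      · rintro ⟨⟨_, t⟩, ⟨ht, htc⟩, rfl⟩
        exact (iInf₂_le (f := fun (t : ℝ≥0) (_ : (_, t) ∈ K) => (t : ℝ≥0∞)) t ht).trans
          (ENNReal.coe_le_coe.2 htc)
    rw [this]
    exact ((hK.inter_right (isClosed_Iic.preimage continuous_snd)).image
      continuous_fst).isClosed.measurableSet

/-- Measurable section theorem. -/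
lemma MeasurableSet.exists_measurable_section {F : MeasurableSpace Ω} (P : Measure Ω)
    [IsFiniteMeasure P] {A : Set (Ω × ℝ≥0)} (hA : MeasurableSet A) {ε : ℝ≥0∞} (hε : ε ≠ 0) :
    ∃ (G : Set Ω) (R : Ω → ℝ≥0), MeasurableSet G ∧ Measurable R ∧ (∀ ω ∈ G, (ω, R ω) ∈ A) ∧
      P (projOmega A) ≤ P G + ε := by
  obtain ⟨φ, hφ, A', hA', rfl⟩ := hA.exists_eq_preimage_cantor
  have : TopologicalSpace.SeparableSpace ((ℕ → Bool) × ℝ≥0) := inferInstance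
  have hana := hA'.analyticSet
  rw [AnalyticSet_def] at hana
  rcases hana with rfl | ⟨f, hf, rfl⟩
  · exact ⟨∅, fun _ => 0, MeasurableSet.empty, measurable_const, by simp, by simp [projOmega]⟩
  obtain ⟨L, hL, hQ⟩ := exists_isCompact_measure_range_le (P.map φ)
    (continuous_fst.comp hf) hε
  have hK : IsCompact (f '' L) := hL.image hf
  have hG : MeasurableSet (Prod.fst '' (f '' L)) :=
    (hK.image continuous_fst).isClosed.measurableSet
  refine ⟨φ ⁻¹' (Prod.fst '' (f '' L)), fun ω => (debut (f '' L) (φ ω)).toNNReal, hφ hG,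
    (hK.measurable_debut.comp hφ).ennreal_toNNReal, fun ω hω => ?_, ?_⟩
  · obtain ⟨t, ht, hd⟩ := exists_isLeast_section hK hω
    simp only [hd, ENNReal.toNNReal_coe]
    exact image_subset_range _ _ ht
  · rw [image_comp, Measure.map_apply hφ hG] at hQ
    refine le_trans (measure_mono ?_) ((Measure.le_map_apply hφ.aemeasurable _).trans hQ)
    rintro _ ⟨⟨ω, t⟩, ⟨n, hn⟩, rfl⟩
    exact ⟨n, congrArg Prod.fst hn⟩

end MeasurableSection

/-- Optional Section Theorem: for every optional set `O` and `ε > 0`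
there is a stopping time `τ` with graph inside `O` and
`ℙ*(π_Ω(O)) − ℙ({τ < ∞}) ≤ ε`. -/
theorem optional_section {Ω : Type*} {F : MeasurableSpace Ω}
    (𝔽 : Filtration ℝ≥0 F) (P : Measure Ω) [IsProbabilityMeasure P]
    (O : Set (Ω × ℝ≥0)) (hO : MeasurableSet[optionalSigma 𝔽] O)
    (ε : ℝ≥0∞) (hε : 0 < ε) :
    ∃ τ : Ω → ℝ≥0∞, IsStopTime 𝔽 τ ∧ graph τ ⊆ O ∧
      pstar P (projOmega O) - P {ω | τ ω < ⊤} ≤ ε := by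
  have hε2 : ε / 2 ≠ 0 := (ENNReal.half_pos hε.ne').ne'
  obtain ⟨G, R, hG, hR, hRO, hPG⟩ :=
    (optionalSigma_le_prod O hO).exists_measurable_section P hε2
  have hmap : Measurable fun ω => (ω, R ω) := measurable_id.prodMk hR
  obtain ⟨B, hBO, hB, hμB⟩ := MeasurableSet.exists_hasAttainedDebuts_subset (P := P)
    ((P.restrict G).map fun ω => (ω, R ω)) hO hε2
  obtain ⟨τ, hτ, hτB, -, hae⟩ := hB (fun _ => 0) fun t => by simp
  refine ⟨τ, hτ, hτB.trans hBO, ?_⟩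
  have hpstar : pstar P (projOmega O) = P (projOmega O) := (measure_eq_iInf _).symm
  have hsub : G ⊆ ((fun ω => (ω, R ω)) ⁻¹' (O \ B) ∩ G) ∪ ({ω | τ ω < ⊤} ∪
      {ω | ¬ ∀ t : ℝ≥0, (ω, t) ∈ B → (0 : ℝ≥0∞) ≤ t → τ ω ≤ t}) := by
    intro ω hω
    by_cases hωB : (ω, R ω) ∈ B
    · by_cases h : ∀ t : ℝ≥0, (ω, t) ∈ B → (0 : ℝ≥0∞) ≤ t → τ ω ≤ t
      · exact Or.inr (Or.inl ((h _ hωB zero_le).trans_lt ENNReal.coe_lt_top))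
      · exact Or.inr (Or.inr h)
    · exact Or.inl ⟨⟨hRO ω hω, hωB⟩, hω⟩
  have hPG' : P G ≤ ε / 2 + P {ω | τ ω < ⊤} := by
    refine (measure_mono hsub).trans ((measure_union_le _ _).trans (add_le_add ?_ ?_))
    · rw [← Measure.restrict_apply' hG]
      exact (Measure.le_map_apply hmap.aemeasurable _).trans hμB
    · exact (measure_union_le _ _).trans_eq (by rw [ae_iff.1 hae, add_zero])
  rw [hpstar, tsub_le_iff_right]
  calc P (projOmega O) ≤ P G + ε / 2 := hPG
    _ ≤ ε / 2 + P {ω | τ ω < ⊤} + ε / 2 := by gcongr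
    _ = ε + P {ω | τ ω < ⊤} := by rw [add_right_comm, ENNReal.add_halves]
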